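/- Let D be a Hom-finite Krull–Schmidt triangulated category with bounded silting object S, and let (X₁, ..., X_t) be a 2_S-term presilting sequence in D. Then the classes [X₁], ..., [X_t] are linearly independent in the Grothendieck group K₀(thick(S)). -/

import Mathlib

open CategoryTheory Limits Pretriangulated ZeroObject

universe v u

namespace Paper

variable {C : Type u} [Category.{v} C] [Preadditive C] [HasZeroObject C]
  [HasShift C ℤ] [∀ n : ℤ, (CategoryTheory.shiftFunctor C n).Additive] [Pretriangulated C]
  [HasBinaryBiproducts C]

/-- A class of objects closed under isomorphism. -/
def ClosedIso (P : C → Prop) : Prop := ∀ ⦃X Y : C⦄, (X ≅ Y) → P X → P Y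

/-- A class of objects closed under extensions. -/
def ExtClosed (P : C → Prop) : Prop :=
  ∀ T : Triangle C, T ∈ (distTriang C) → P T.obj₁ → P T.obj₃ → P T.obj₂

/-- A suspended subcategory: additive (iso-closed, contains 0, closed under finite sums via
extensions), closed under the suspension `Σ = ⟦1⟧` and under extensions. -/
structure Suspended (P : C → Prop) : Prop where
  iso : ClosedIso P
  zero : P 0
  shift : ∀ ⦃X : C⦄, P X → P (X⟦(1:ℤ)⟧)
  ext : ExtClosed P

/-- A t-structure `(L, G) = (D^{≤0}, D^{>0})`: Hom-orthogonality, every object is an extension,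
`L` is suspended; both classes are closed under isomorphism. -/
structure IsTStr (L G : C → Prop) : Prop where
  isoL : ClosedIso L
  isoG : ClosedIso G
  zeroL : L 0
  homZero : ∀ ⦃X Y : C⦄, L X → G Y → ∀ f : X ⟶ Y, f = 0
  trunc : ∀ X : C, ∃ (A B : C) (f : A ⟶ X) (g : X ⟶ B) (h : B ⟶ A⟦(1:ℤ)⟧),
    Triangle.mk f g h ∈ (distTriang C) ∧ L A ∧ G B
  shiftL : ∀ ⦃X : C⦄, L X → L (X⟦(1:ℤ)⟧)
  extL : ExtClosed L

/-- The right orthogonal `U^{⊥₀}` of a class of objects. -/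
def rightOrth (U : C → Prop) (Y : C) : Prop := ∀ X : C, U X → ∀ f : X ⟶ Y, f = 0

/-- `Y ∈ P^{⊥_{≤ m}}`: `Hom(P, Σ^i Y) = 0` for all `i ≤ m`. -/
def perpLe (P : C) (m : ℤ) (Y : C) : Prop := ∀ i : ℤ, i ≤ m → ∀ f : P ⟶ Y⟦i⟧, f = 0

/-- `Y ∈ P^{⊥_{> m}}`: `Hom(P, Σ^i Y) = 0` for all `i > m`. -/
def perpGt (P : C) (m : ℤ) (Y : C) : Prop := ∀ i : ℤ, m < i → ∀ f : P ⟶ Y⟦i⟧, f = 0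

/-- `Y ∈ P^{⊥_ℤ}`: `Hom(P, Σ^i Y) = 0` for all integers `i`. -/
def perpZ (P : C) (Y : C) : Prop := ∀ i : ℤ, ∀ f : P ⟶ Y⟦i⟧, f = 0

/-- `X ∈ ^{⊥_{>0}}P`: `Hom(X, Σ^i P) = 0` for all `i > 0`. -/
def leftPerpGt0 (P : C) (X : C) : Prop := ∀ i : ℤ, 0 < i → ∀ f : X ⟶ P⟦i⟧, f = 0

/-- `susp(P)`, the smallest suspended subcategory containing `P`. -/
def suspObj (P : C) (X : C) : Prop := ∀ U : C → Prop, Suspended U → U P → U X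

/-- An additive subcategory closed under direct summands. -/
structure AddSub (U : C → Prop) : Prop where
  iso : ClosedIso U
  zero : U 0
  biprod : ∀ X Y : C, U X → U Y → U (X ⊞ Y)
  summand : ∀ X Y : C, U (X ⊞ Y) → U X

/-- `add(P)`: the additive closure of `P` (finite direct sums of direct summands). -/
def addObj (P : C) (X : C) : Prop := ∀ U : C → Prop, AddSub U → U P → U X

/-- A thick triangulated subcategory. -/
structure ThickSub (U : C → Prop) : Prop where
  iso : ClosedIso U
  zero : U 0
  shift : ∀ ⦃X : C⦄, U X → ∀ n : ℤ, U (X⟦n⟧)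
  ext : ExtClosed U
  summand : ∀ X Y : C, U (X ⊞ Y) → U X

/-- `thick(P)`: the smallest thick subcategory containing `P`. -/
def thickObj (P : C) (X : C) : Prop := ∀ U : C → Prop, ThickSub U → U P → U X

/-- A triangulated subcategory (iso-closed, shift-closed both ways, extension-closed). -/
structure TriangSub (U : C → Prop) : Prop where
  iso : ClosedIso U
  zero : U 0
  shift : ∀ ⦃X : C⦄, U X → ∀ n : ℤ, U (X⟦n⟧)
  ext : ExtClosed U

/-- `P` is presilting: `Hom(P, Σ^n P) = 0` for all `n > 0`. -/
def Presilting (P : C) : Prop := ∀ n : ℤ, 0 < n → ∀ f : P ⟶ P⟦n⟧, f = 0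

/-- `P` is partial silting: `(susp(P), P^{⊥_{≤0}})` is a t-structure and
`susp(P) ⊆ P^{⊥_{>0}}`. -/
def PartialSilting (P : C) : Prop :=
  IsTStr (suspObj P) (perpLe P 0) ∧ ∀ X : C, suspObj P X → perpGt P 0 X

/-- `S` is silting: partial silting with `susp(S) = S^{⊥_{>0}}`. -/
def Silting (S : C) : Prop :=
  PartialSilting S ∧ ∀ X : C, suspObj S X ↔ perpGt S 0 X

/-- `X ∈ D^{≤ n}` for the t-structure with aisle `L`. -/
def DLe (L : C → Prop) (n : ℤ) (X : C) : Prop := L (X⟦n⟧)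

/-- `X ∈ D^{> m}` for the t-structure with co-aisle `G`. -/
def DGt (G : C → Prop) (m : ℤ) (X : C) : Prop := G (X⟦m⟧)

/-- The t-structure `(L, G)` is bounded. -/
def BoundedTStr (L G : C → Prop) : Prop :=
  ∀ X : C, (∃ n : ℤ, DLe L n X) ∧ (∃ m : ℤ, DGt G m X)

/-- `H` is (a choice of) the `i`-th cohomology `H^i(X) = σ^{≤ i} σ^{> i-1} X` of `X` with
respect to the t-structure `(L, G)`, expressed by the two truncation triangles. -/
def IsCohomAt (L G : C → Prop) (i : ℤ) (X H : C) : Prop :=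
  ∃ (A B B' : C) (f : A ⟶ X) (g : X ⟶ B) (h : B ⟶ A⟦(1:ℤ)⟧)
    (f' : H ⟶ B) (g' : B ⟶ B') (h' : B' ⟶ H⟦(1:ℤ)⟧),
    Triangle.mk f g h ∈ (distTriang C) ∧ DLe L (i-1) A ∧ DGt G (i-1) B ∧
    Triangle.mk f' g' h' ∈ (distTriang C) ∧ DLe L i H ∧ DGt G i B'

/-- The heart `D^0 = D^{≤0} ∩ D^{>-1}` of the t-structure `(L, G)`. -/
def Heart (L G : C → Prop) (X : C) : Prop := L X ∧ DGt G (-1) X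

/-- A t-exact subcategory: a triangulated subcategory closed under the truncation `σ^{≤0}`
of the t-structure `(L, G)`. -/
def TExactSub (L G : C → Prop) (S : C → Prop) : Prop :=
  TriangSub S ∧
    ∀ (X A B : C) (f : A ⟶ X) (g : X ⟶ B) (h : B ⟶ A⟦(1:ℤ)⟧),
      S X → Triangle.mk f g h ∈ (distTriang C) → L A → G B → S A


/-- The class of objects `U` admits coreflections: every object has a couniversal morphism
from `U`, i.e. the inclusion of `U` admits a right adjoint. -/
def HasCoreflections (U : C → Prop) : Prop :=
  ∀ X : C, ∃ (A : C) (ε : A ⟶ X), U A ∧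
    ∀ A' : C, U A' → ∀ g : A' ⟶ X, ∃! g' : A' ⟶ A, g' ≫ ε = g

/-- `X` is a `2_S`-term object: `X ∈ add(S) * Σ add(S)`. -/
def TwoTerm (S X : C) : Prop :=
  ∃ (S₁ S₀ : C) (f : S₁ ⟶ S₀) (g : S₀ ⟶ X) (h : X ⟶ S₁⟦(1:ℤ)⟧),
    Triangle.mk f g h ∈ (distTriang C) ∧ addObj S S₁ ∧ addObj S S₀

/-- `X` is indecomposable. -/
def Indec (X : C) : Prop :=
  ¬ IsZero X ∧ ∀ Y Z : C, (X ≅ Y ⊞ Z) → IsZero Y ∨ IsZero Z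

/-- `add(A)` is contravariantly finite: every object admits a right `add(A)`-approximation. -/
def ContravFinAdd (A : C) : Prop :=
  ∀ X : C, ∃ (Q : C) (q : Q ⟶ X), addObj A Q ∧
    ∀ Q' : C, addObj A Q' → ∀ g : Q' ⟶ X, ∃ g' : Q' ⟶ Q, g' ≫ q = g

/-- `S` is a bounded silting object. -/
def BoundedSilting (S : C) : Prop :=
  Silting S ∧ BoundedTStr (suspObj S) (perpLe S 0)

/-- Hom-finiteness of `C` over a field `k`. -/
def HomFinite (k : Type w) [Field k] [Linear k C] : Prop :=
  ∀ X Y : C, FiniteDimensional k (X ⟶ Y)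

/-- The Krull–Schmidt property: every object is a finite direct sum of objects with local
endomorphism rings. -/
def KrullSchmidt : Prop :=
  ∀ X : C, ∃ l : List C, (∀ Y ∈ l, IsLocalRing (End Y)) ∧
    Nonempty (X ≅ l.foldr (· ⊞ ·) 0)

/-- A wide subcategory of the heart of the t-structure `(L, G)`: closed under isomorphisms,
extensions, kernels and cokernels (the latter two expressed via cones and cohomology). -/
structure HeartWide (L G W : C → Prop) : Prop where
  sub : ∀ ⦃X : C⦄, W X → Heart L G X
  iso : ClosedIso W
  ext : ∀ (X Y Z : C) (f : X ⟶ Y) (g : Y ⟶ Z) (h : Z ⟶ X⟦(1:ℤ)⟧),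
    W X → W Z → Heart L G Y → Triangle.mk f g h ∈ (distTriang C) → W Y
  kerCoker : ∀ (X Y Z : C) (f : X ⟶ Y) (g : Y ⟶ Z) (h : Z ⟶ X⟦(1:ℤ)⟧),
    W X → W Y → Triangle.mk f g h ∈ (distTriang C) →
    (∀ K : C, IsCohomAt L G (-1) Z K → W K) ∧ (∀ Q : C, IsCohomAt L G 0 Z Q → W Q)

/-- The subgroup of relations defining `K₀` of the thick subcategory `S`. -/
def K0Rel (S : C → Prop) : AddSubgroup (FreeAbelianGroup C) :=
  AddSubgroup.closure
    {x | (∃ X : C, ¬ S X ∧ x = FreeAbelianGroup.of X) ∨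
      ∃ T : Triangle C, T ∈ (distTriang C) ∧ S T.obj₁ ∧ S T.obj₂ ∧ S T.obj₃ ∧
        x = FreeAbelianGroup.of T.obj₂ - FreeAbelianGroup.of T.obj₁
          - FreeAbelianGroup.of T.obj₃}

/-- The Grothendieck group of the (thick) subcategory `S`. -/
abbrev K0 (S : C → Prop) := FreeAbelianGroup C ⧸ K0Rel S

/-- The class `[X]` in the Grothendieck group. -/
def K0cls (S : C → Prop) (X : C) : K0 S :=
  QuotientAddGroup.mk (FreeAbelianGroup.of X)

/-- A `2_S`-term presilting sequence `(X₁, …, X_t)` in the ambient subcategory `Amb` with respect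
to the silting object `S`, defined recursively: the last term `X` is an indecomposable `2_S`-term
presilting object, and the truncated sequence is a `2_{σ^{>0}_X T}`-term presilting sequence in
`Amb ∩ X^{⊥_ℤ}`, where `T = X ⊕ Q` is the Bongartz completion of `X`. -/
inductive PresiltSeq : (C → Prop) → C → List C → Prop
  | nil (Amb : C → Prop) (S : C) : PresiltSeq Amb S []
  | cons (Amb : C → Prop) (S X : C) (l : List C)
      (hX : Amb X) (h2 : TwoTerm S X) (hpre : Presilting X) (hind : Indec X)
      -- Bongartz completion `T = X ⊞ Q`, via an approximation triangle `S → Q → X₀ → ΣS`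
      (Q X₀ : C) (i : S ⟶ Q) (p : Q ⟶ X₀) (β : X₀ ⟶ S⟦(1:ℤ)⟧)
      (hB : Triangle.mk i p β ∈ (distTriang C)) (hX₀ : addObj X X₀)
      (happrox : ∀ X' : C, addObj X X' → ∀ g : X' ⟶ S⟦(1:ℤ)⟧, ∃ g', g' ≫ β = g)
      -- the truncation `T' = σ^{>0}_X (X ⊞ Q)`
      (T' A : C) (f : A ⟶ X ⊞ Q) (g : X ⊞ Q ⟶ T') (h : T' ⟶ A⟦(1:ℤ)⟧)
      (hTr : Triangle.mk f g h ∈ (distTriang C)) (hA : suspObj X A) (hT' : perpLe X 0 T')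
      (hrest : PresiltSeq (fun Y => Amb Y ∧ perpZ X Y) T' l) :
      PresiltSeq Amb S (l ++ [X])


section Vanishing

/-- `Hom(P, Σ^i Y) = 0`. -/
def HomZero (P Y : C) (i : ℤ) : Prop := ∀ f : P ⟶ Y⟦i⟧, f = 0

namespace HomZero

omit [HasZeroObject C] [Pretriangulated C] [HasBinaryBiproducts C]

lemma shift_both {P Y : C} {i : ℤ} (H : HomZero P Y i) (a j : ℤ) (h : i + a = j) :
    HomZero (P⟦a⟧) Y j := by
  intro f
  obtain ⟨g, hg⟩ := (CategoryTheory.shiftFunctor C a).map_surjective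
    (f ≫ (shiftFunctorAdd' C i a j h).hom.app Y)
  rw [H g, Functor.map_zero] at hg
  rw [← cancel_mono ((shiftFunctorAdd' C i a j h).hom.app Y), ← hg, zero_comp]

lemma of_shift_both {P Y : C} {j : ℤ} {a : ℤ} (H : HomZero (P⟦a⟧) Y j) (i : ℤ) (h : i + a = j) :
    HomZero P Y i := by
  intro f
  have h0 := H (f⟦a⟧' ≫ (shiftFunctorAdd' C i a j h).inv.app Y)
  apply (CategoryTheory.shiftFunctor C a).map_injective
  rw [Functor.map_zero, ← cancel_mono ((shiftFunctorAdd' C i a j h).inv.app Y), h0, zero_comp]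

omit [∀ n : ℤ, (CategoryTheory.shiftFunctor C n).Additive] in
lemma shift_right {P Y : C} {j : ℤ} (H : HomZero P Y j) (a i : ℤ) (h : a + i = j) :
    HomZero P (Y⟦a⟧) i := by
  intro f
  have h0 := H (f ≫ (shiftFunctorAdd' C a i j h).inv.app Y)
  rw [← cancel_mono ((shiftFunctorAdd' C a i j h).inv.app Y), h0, zero_comp]

omit [∀ n : ℤ, (CategoryTheory.shiftFunctor C n).Additive] in
lemma of_shift_right {P Y : C} {a i : ℤ} (H : HomZero P (Y⟦a⟧) i) (j : ℤ) (h : a + i = j) :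
    HomZero P Y j := by
  intro f
  have h0 := H (f ≫ (shiftFunctorAdd' C a i j h).hom.app Y)
  rw [← cancel_mono ((shiftFunctorAdd' C a i j h).hom.app Y), h0, zero_comp]

lemma of_shift_left_zero {P Y : C} {a : ℤ} (H : ∀ f : P⟦a⟧ ⟶ Y, f = 0) (i : ℤ) (h : i + a = 0) :
    HomZero P Y i := by
  refine of_shift_both (a := a) (j := 0) (fun f => ?_) i h
  rw [← cancel_mono ((shiftFunctorZero C ℤ).hom.app Y), zero_comp]
  exact H _

lemma shift_left_zero {P Y : C} {i : ℤ} (H : HomZero P Y i) (a : ℤ) (h : i + a = 0)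
    (f : P⟦a⟧ ⟶ Y) : f = 0 := by
  have h0 := H.shift_both a 0 h (f ≫ (shiftFunctorZero C ℤ).inv.app Y)
  rw [← cancel_mono ((shiftFunctorZero C ℤ).inv.app Y), h0, zero_comp]

omit [∀ n : ℤ, (CategoryTheory.shiftFunctor C n).Additive] in
lemma of_retract {P P' Y : C} {i : ℤ} (H : HomZero P Y i) (s : P' ⟶ P) (r : P ⟶ P')
    (h : s ≫ r = 𝟙 _) : HomZero P' Y i := by
  intro f
  rw [← Category.id_comp f, ← h, Category.assoc, H (r ≫ f), comp_zero]

omit [∀ n : ℤ, (CategoryTheory.shiftFunctor C n).Additive] in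
lemma of_retract_right {P Y Y' : C} {i : ℤ} (H : HomZero P Y i) (s : Y' ⟶ Y) (r : Y ⟶ Y')
    (h : s ≫ r = 𝟙 _) : HomZero P Y' i := by
  intro f
  rw [← Category.comp_id f, ← (CategoryTheory.shiftFunctor C i).map_id, ← h, Functor.map_comp,
    ← Category.assoc, H (f ≫ s⟦i⟧'), zero_comp]

end HomZero

omit [HasBinaryBiproducts C] in
lemma homZero_covariant {T : Triangle C} (hT : T ∈ distTriang C) {P : C} {i : ℤ}
    (h₁ : HomZero P T.obj₁ i) (h₃ : HomZero P T.obj₃ i) : HomZero P T.obj₂ i := by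
  intro f
  obtain ⟨g, rfl⟩ := Triangle.coyoneda_exact₂ _ (Triangle.shift_distinguished T hT i) f (h₃ _)
  rw [show g = 0 from h₁ g, zero_comp]
  rfl

omit [HasBinaryBiproducts C] in
lemma homZero_covariant₃ {T : Triangle C} (hT : T ∈ distTriang C) {P : C} {i : ℤ}
    (h₂ : HomZero P T.obj₂ i) (h₁ : HomZero P T.obj₁ (i + 1)) : HomZero P T.obj₃ i :=
  homZero_covariant (rot_of_distTriang _ hT) h₂ (h₁.shift_right 1 i (by ring))

omit [HasBinaryBiproducts C] in
lemma homZero_covariant₁ {T : Triangle C} (hT : T ∈ distTriang C) {P : C} {i : ℤ}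
    (h₂ : HomZero P T.obj₂ i) (h₃ : HomZero P T.obj₃ (i - 1)) : HomZero P T.obj₁ i := by
  have h : HomZero P (T.obj₁⟦(1 : ℤ)⟧) (i - 1) :=
    homZero_covariant (rot_of_distTriang _ (rot_of_distTriang _ hT)) h₃
      (h₂.shift_right 1 (i - 1) (by ring))
  exact h.of_shift_right i (by ring)

omit [HasBinaryBiproducts C] in
lemma homZero_contravariant {T : Triangle C} (hT : T ∈ distTriang C) {Y : C} {i : ℤ}
    (h₁ : HomZero T.obj₁ Y i) (h₃ : HomZero T.obj₃ Y i) : HomZero T.obj₂ Y i := by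
  intro f
  obtain ⟨g, rfl⟩ := Triangle.yoneda_exact₂ _ hT f (h₁ _)
  rw [h₃ g, comp_zero]

omit [HasBinaryBiproducts C] in
lemma homZero_contravariant₃ {T : Triangle C} (hT : T ∈ distTriang C) {Y : C} {i : ℤ}
    (h₂ : HomZero T.obj₂ Y i) (h₁ : HomZero T.obj₁ Y (i - 1)) : HomZero T.obj₃ Y i :=
  homZero_contravariant (rot_of_distTriang _ hT) h₂ (h₁.shift_both 1 i (by ring))

omit [HasZeroObject C] [∀ n : ℤ, (CategoryTheory.shiftFunctor C n).Additive]
  [Pretriangulated C] in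
lemma HomZero.biprod {P Q Y : C} {i : ℤ} (hP : HomZero P Y i) (hQ : HomZero Q Y i) :
    HomZero (P ⊞ Q) Y i := by
  intro f
  apply biprod.hom_ext'
  · rw [hP (biprod.inl ≫ f), comp_zero]
  · rw [hQ (biprod.inr ≫ f), comp_zero]

omit [∀ n : ℤ, (CategoryTheory.shiftFunctor C n).Additive] [Pretriangulated C] in
lemma HomZero.of_addObj {S X Y : C} {i : ℤ} (H : HomZero S Y i) (hX : addObj S X) :
    HomZero X Y i := by
  refine hX (fun P => HomZero P Y i) ⟨?_, ?_, ?_, ?_⟩ H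
  · intro P P' e h
    exact h.of_retract e.inv e.hom (by simp)
  · intro f
    exact (isZero_zero C).eq_of_src _ _
  · intro P P' h h'
    exact h.biprod h'
  · intro P P' h
    exact h.of_retract biprod.inl biprod.fst (by simp)

lemma HomZero.of_twoTerm {S X Y : C} {i : ℤ} (hX : TwoTerm S X) (H : HomZero S Y i)
    (H' : HomZero S Y (i - 1)) : HomZero X Y i := by
  obtain ⟨S₁, S₀, f, g, h, hT, h₁, h₀⟩ := hX
  exact homZero_contravariant₃ hT (H.of_addObj h₀) (H'.of_addObj h₁)

/-- A two-term object without maps from `S` in degree zero lies in `Σ add(S)` up to summands. -/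
lemma HomZero.of_twoTerm_of_homZero {S X Y : C} {i : ℤ} (hX : TwoTerm S X) (H₀ : HomZero S X 0)
    (H' : HomZero S Y (i - 1)) : HomZero X Y i := by
  obtain ⟨S₁, S₀, f, g, h, hT, h₁, h₀⟩ := hX
  intro u
  have hg : g = 0 := by
    rw [← cancel_mono ((shiftFunctorZero C ℤ).inv.app X), zero_comp]
    exact H₀.of_addObj h₀ _
  obtain ⟨v, rfl⟩ := Triangle.yoneda_exact₃ _ hT u (by rw [hg]; exact zero_comp)
  rw [show v = 0 from (H'.of_addObj h₁).shift_both 1 i (by ring) v, comp_zero]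
  rfl

omit [HasBinaryBiproducts C] in
lemma homZero_of_suspObj {X A Y : C} (H : perpZ X Y) (hA : suspObj X A) : perpZ A Y := by
  refine hA (fun P => perpZ P Y) ⟨?_, ?_, ?_, ?_⟩ H
  · intro P P' e h i
    exact HomZero.of_retract (h i) e.inv e.hom (by simp)
  · intro i f
    exact (isZero_zero C).eq_of_src _ _
  · intro P h i
    exact HomZero.shift_both (h (i - 1)) 1 i (by ring)
  · intro T hT h₁ h₃ i
    exact homZero_contravariant hT (h₁ i) (h₃ i)

end Vanishing

section Truncation

/-- `Amb` is closed under shifts, and each of its objects is, within `Amb`, an extension of an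
object of `S^{⊥_{≤0}}` by an object of `S^{⊥_{>0}}`. -/
structure Truncates (Amb : C → Prop) (S : C) : Prop where
  shift : ∀ ⦃Y : C⦄, Amb Y → ∀ n : ℤ, Amb (Y⟦n⟧)
  trunc : ∀ Y : C, Amb Y → ∃ (A B : C) (f : A ⟶ Y) (g : Y ⟶ B) (h : B ⟶ A⟦(1:ℤ)⟧),
    Triangle.mk f g h ∈ (distTriang C) ∧ Amb A ∧ Amb B ∧ perpGt S 0 A ∧ perpLe S 0 B

omit [HasBinaryBiproducts C] in
lemma Truncates.of_partialSilting {S : C} (hS : PartialSilting S) :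
    Truncates (fun _ : C => True) S where
  shift _ _ _ := trivial
  trunc Y _ := by
    obtain ⟨A, B, f, g, h, hT, hA, hB⟩ := hS.1.trunc Y
    exact ⟨A, B, f, g, h, hT, trivial, trivial, hS.2 A hA, hB⟩

/-- Truncation triangles with respect to `S` stay inside `X^{⊥_ℤ}` when `X` is two-term. -/
lemma perpZ_of_truncation {S X : C} (hX : TwoTerm S X) {T : Triangle C} (hT : T ∈ distTriang C)
    (hY : perpZ X T.obj₂) (hA : perpGt S 0 T.obj₁) (hB : perpLe S 0 T.obj₃) :
    perpZ X T.obj₁ ∧ perpZ X T.obj₃ := by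
  have h₁ : perpZ X T.obj₁ := by
    intro i
    by_cases hi : 2 ≤ i
    · exact HomZero.of_twoTerm hX (hA i (by omega)) (hA (i - 1) (by omega))
    · exact homZero_covariant₁ hT (hY i)
        (HomZero.of_twoTerm hX (hB (i - 1) (by omega)) (hB (i - 1 - 1) (by omega)))
  exact ⟨h₁, fun i => homZero_covariant₃ hT (hY i) (h₁ (i + 1))⟩

/-- On `X^{⊥_ℤ}`, vanishing of maps from `S` implies vanishing of maps from the truncation of the
Bongartz completion. -/
lemma HomZero.of_bongartz {S X Q X₀ T' A : C} {i : S ⟶ Q} {p : Q ⟶ X₀} {β : X₀ ⟶ S⟦(1:ℤ)⟧}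
    (hB : Triangle.mk i p β ∈ (distTriang C)) (hX₀ : addObj X X₀)
    {f : A ⟶ X ⊞ Q} {g : X ⊞ Q ⟶ T'} {h : T' ⟶ A⟦(1:ℤ)⟧}
    (hTr : Triangle.mk f g h ∈ (distTriang C)) (hA : suspObj X A)
    {Z : C} (hZ : perpZ X Z) {n : ℤ} (H : HomZero S Z n) : HomZero T' Z n := by
  have hQ : HomZero Q Z n := homZero_contravariant hB H (HomZero.of_addObj (hZ n) hX₀)
  exact homZero_contravariant₃ hTr (HomZero.biprod (hZ n) hQ) (homZero_of_suspObj hZ hA (n - 1))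

lemma Truncates.perp {Amb : C → Prop} {S X T' : C} (hS : Truncates Amb S) (hX : TwoTerm S X)
    (hT' : ∀ (Z : C), perpZ X Z → ∀ n : ℤ, HomZero S Z n → HomZero T' Z n) :
    Truncates (fun Y => Amb Y ∧ perpZ X Y) T' where
  shift Y hY n := ⟨hS.shift hY.1 n, fun i => HomZero.shift_right (hY.2 (n + i)) n i rfl⟩
  trunc Y hY := by
    obtain ⟨A, B, f, g, h, hT, hA, hB, hA', hB'⟩ := hS.trunc Y hY.1
    obtain ⟨hXA, hXB⟩ := perpZ_of_truncation hX hT hY.2 hA' hB'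
    exact ⟨A, B, f, g, h, hT, ⟨hA, hXA⟩, ⟨hB, hXB⟩, fun i hi => hT' A hXA i (hA' i hi),
      fun i hi => hT' B hXB i (hB' i hi)⟩

omit [HasBinaryBiproducts C] in
/-- If the map from `Σ^c X` to its coaisle part vanishes, then `S` has no maps to `X` in degrees
above `c`. -/
lemma homZero_of_truncation_eq_zero {S X A B : C} {c : ℤ} {f : A ⟶ X⟦c⟧} {g : X⟦c⟧ ⟶ B}
    {h : B ⟶ A⟦(1:ℤ)⟧} (hT : Triangle.mk f g h ∈ (distTriang C)) (hA : perpGt S 0 A)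
    (hg : g = 0) (j : ℤ) (hj : c < j) : HomZero S X j := by
  obtain ⟨s, hs⟩ := Triangle.coyoneda_exact₂ _ hT (𝟙 (X⟦c⟧)) (by rw [hg]; exact comp_zero)
  have := HomZero.of_retract_right (hA (j - c) (by omega)) s f hs.symm
  exact this.of_shift_right j (by ring)

/-- A nonzero two-term presilting object of `Amb` has maps to some object of `Amb` in exactly one
degree. -/
lemma Truncates.exists_concentrated {Amb : C → Prop} {S X : C} (hS : Truncates Amb S)
    (hAmb : Amb X) (hX : TwoTerm S X) (hpre : Presilting X) (hne : ¬ IsZero X) :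
    ∃ (B : C) (m : ℤ), Amb B ∧ (∀ i, i ≠ m → HomZero X B i) ∧ ¬ HomZero X B m := by
  obtain ⟨A, B, f, g, h, hT, -, hB, hA', hB'⟩ := hS.trunc _ (hS.shift hAmb (-1))
  by_cases hg : g = 0
  · have hSX : ∀ j : ℤ, -1 < j → HomZero S X j := homZero_of_truncation_eq_zero hT hA' hg
    obtain ⟨A, B, f, g, h, hT, -, hB, hA', hB'⟩ := hS.trunc _ (hS.shift hAmb (-2))
    refine ⟨B, 2, hB, fun i hi => ?_, fun h2 => ?_⟩
    · by_cases hi' : i ≤ 1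
      · exact HomZero.of_twoTerm_of_homZero hX (hSX 0 (by omega)) (hB' _ (by omega))
      · refine homZero_covariant₃ hT
          (HomZero.shift_right (hpre (-2 + i) (by omega)) (-2) i rfl) ?_
        exact HomZero.of_twoTerm hX (hA' _ (by omega)) (hA' _ (by omega))
    · have hg : g = 0 := h2.shift_left_zero (-2) (by norm_num) g
      have h1 := homZero_of_truncation_eq_zero hT hA' hg (-1) (by norm_num)
      apply hne
      rw [IsZero.iff_id_eq_zero, ← cancel_mono ((shiftFunctorZero C ℤ).inv.app X), zero_comp]
      exact HomZero.of_twoTerm hX (hSX 0 (by omega)) h1 _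
  · refine ⟨B, 1, hB, fun i hi => ?_, fun h1 => hg (h1.shift_left_zero (-1) (by norm_num) g)⟩
    by_cases hi' : i ≤ 0
    · exact HomZero.of_twoTerm hX (hB' _ (by omega)) (hB' _ (by omega))
    · refine homZero_covariant₃ hT (HomZero.shift_right (hpre (-1 + i) (by omega)) (-1) i rfl) ?_
      exact HomZero.of_twoTerm hX (hA' _ (by omega)) (hA' _ (by omega))

end Truncation

section Bounded

variable {S : C}

omit [HasBinaryBiproducts C] in
lemma BoundedSilting.of_suspended (hS : BoundedSilting S) {U : C → Prop} (hU : Suspended U)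
    (hSU : U S) (hshift : ∀ ⦃X : C⦄, U X → ∀ n : ℤ, U (X⟦n⟧)) (X : C) : U X := by
  obtain ⟨⟨n, hn⟩, -⟩ := hS.2 X
  exact hU.iso ((shiftEquiv C n).unitIso.symm.app X) (hshift (hn U hU hSU) (-n))

lemma BoundedSilting.thickObj (hS : BoundedSilting S) (X : C) : thickObj S X := by
  intro U hU hSU
  exact hS.of_suspended ⟨hU.iso, hU.zero, fun Y hY => hU.shift hY 1, hU.ext⟩ hSU hU.shift X

omit [HasBinaryBiproducts C] in
lemma BoundedSilting.finite_homZero (hS : BoundedSilting S) (X : C) :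
    ∀ Y : C, {i : ℤ | ¬ HomZero X Y i}.Finite := by
  refine hS.of_suspended (U := fun X => ∀ Y : C, {i : ℤ | ¬ HomZero X Y i}.Finite) ?_ ?_ ?_ X
  · refine ⟨?_, ?_, ?_, ?_⟩
    · intro P P' e h Y
      exact (h Y).subset fun i hi h' => hi (h'.of_retract e.inv e.hom (by simp))
    · intro Y
      refine Set.finite_empty.subset fun i hi => hi fun f => ?_
      exact (isZero_zero C).eq_of_src _ _
    · intro P h Y
      refine ((h Y).image (· + 1)).subset fun i hi => ⟨i - 1, fun h' => ?_, by simp⟩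
      exact hi (h'.shift_both 1 i (by ring))
    · intro T hT h₁ h₃ Y
      refine ((h₁ Y).union (h₃ Y)).subset fun i hi => ?_
      by_contra hc
      simp only [Set.mem_union, Set.mem_ofPred_eq, not_or, not_not] at hc
      exact hi (homZero_contravariant hT hc.1 hc.2)
  · intro Y
    obtain ⟨⟨n, hn⟩, ⟨m, hm⟩⟩ := hS.2 Y
    refine (Set.finite_Ioc m n).subset fun i hi => ?_
    constructor <;> by_contra hc
    · exact hi (HomZero.of_shift_right (hm (i - m) (by omega)) i (by ring))
    · exact hi (HomZero.of_shift_right (hS.1.1.2 _ hn (i - n) (by omega)) i (by ring))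
  · intro P h n Y
    refine ((h Y).image (· + n)).subset fun i hi => ⟨i - n, fun h' => ?_, by simp⟩
    exact hi (h'.shift_both n i (by ring))

end Bounded

section EulerForm

variable (k : Type w) [Field k] [Linear k C]

/-- The rank of precomposition with `f` on maps to `L`. -/
noncomputable def precompRank (L : C) {X Y : C} (f : X ⟶ Y) : ℕ :=
  Module.finrank k (LinearMap.range (Linear.leftComp k L f))

section

omit [HasZeroObject C] [HasShift C ℤ] [∀ n : ℤ, (CategoryTheory.shiftFunctor C n).Additive]
  [Pretriangulated C] [HasBinaryBiproducts C]

lemma precompRank_neg (L : C) {X Y : C} (f : X ⟶ Y) :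
    precompRank k L (-f) = precompRank k L f := by
  have : Linear.leftComp k L (-f) = -Linear.leftComp k L f := by
    ext; simp
  rw [precompRank, this, LinearMap.range_neg, precompRank]

lemma precompRank_units_smul (L : C) {X Y : C} (f : X ⟶ Y) (u : ℤˣ) :
    precompRank k L (u • f) = precompRank k L f := by
  obtain rfl | rfl := Int.units_eq_one_or u
  · rw [one_smul]
  · rw [Units.neg_smul, one_smul, precompRank_neg]

lemma precompRank_of_isos (L : C) {X Y X' Y' : C} (f : X ⟶ Y) (f' : X' ⟶ Y') (e : X ≅ X')
    (e' : Y ≅ Y') (h : f ≫ e'.hom = e.hom ≫ f') : precompRank k L f = precompRank k L f' := by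
  obtain rfl : f' = e.inv ≫ f ≫ e'.hom := by rw [h, Iso.inv_hom_id_assoc]
  refine LinearEquiv.finrank_eq (LinearEquiv.ofLinearMap
    ((Linear.leftComp k L e.inv).restrict ?_) ((Linear.leftComp k L e.hom).restrict ?_) ?_ ?_)
  · rintro _ ⟨u, rfl⟩
    exact ⟨e'.inv ≫ u, by simp⟩
  · rintro _ ⟨u, rfl⟩
    exact ⟨e'.hom ≫ u, by simp⟩
  · ext u
    simp
  · ext u
    simp

end

omit [HasBinaryBiproducts C] in
lemma finrank_hom_eq_precompRank_add (hfin : HomFinite (C := C) k) (L : C) {T : Triangle C}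
    (hT : T ∈ distTriang C) : Module.finrank k (T.obj₂ ⟶ L) =
      precompRank k L T.mor₁ + precompRank k L T.mor₂ := by
  have := hfin T.obj₂ L
  have : LinearMap.ker (Linear.leftComp k L T.mor₁) =
      LinearMap.range (Linear.leftComp k L T.mor₂) := by
    ext u
    constructor
    · intro hu
      obtain ⟨v, hv⟩ := Triangle.yoneda_exact₂ T hT u hu
      exact ⟨v, hv.symm⟩
    · rintro ⟨v, rfl⟩
      simp [comp_distTriang_mor_zero₁₂_assoc _ hT]
  rw [← LinearMap.finrank_range_add_finrank_ker (Linear.leftComp k L T.mor₁), this]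
  rfl

/-- The Euler form `∑ (-1)^i dim Hom(Σ^i X, L)`. -/
noncomputable def eulerForm (X L : C) : ℤ :=
  ∑ᶠ i : ℤ, (i.negOnePow : ℤ) * Module.finrank k (X⟦i⟧ ⟶ L)

omit [HasZeroObject C] [Pretriangulated C] [HasBinaryBiproducts C] in
lemma finrank_shift_eq_zero {X L : C} {i : ℤ} (h : HomZero X L (-i)) :
    Module.finrank k (X⟦i⟧ ⟶ L) = 0 := by
  have : Subsingleton (X⟦i⟧ ⟶ L) := ⟨fun f g => by
    rw [h.shift_left_zero i (by ring) f, h.shift_left_zero i (by ring) g]⟩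
  exact Module.finrank_zero_of_subsingleton

omit [HasZeroObject C] [Pretriangulated C] [HasBinaryBiproducts C] in
lemma finite_support_finrank {X L : C} (h : {i : ℤ | ¬ HomZero X L i}.Finite) :
    {i : ℤ | Module.finrank k (X⟦i⟧ ⟶ L) ≠ 0}.Finite :=
  (h.image Neg.neg).subset fun i hi =>
    ⟨-i, fun h' => hi (finrank_shift_eq_zero k h'), neg_neg i⟩

omit [HasZeroObject C] [Pretriangulated C] [HasBinaryBiproducts C] in
lemma eulerForm_eq_zero {X L : C} (h : perpZ X L) : eulerForm k X L = 0 := by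
  rw [eulerForm, ← finsum_zero (α := ℤ)]
  congr 1
  ext i
  rw [finrank_shift_eq_zero k (h (-i)), Nat.cast_zero, mul_zero]

omit [HasZeroObject C] [Pretriangulated C] [HasBinaryBiproducts C] in
lemma eulerForm_ne_zero (hfin : HomFinite (C := C) k) {X L : C} {m : ℤ}
    (h : ∀ i, i ≠ m → HomZero X L i) (hm : ¬ HomZero X L m) : eulerForm k X L ≠ 0 := by
  rw [eulerForm, finsum_eq_single _ (-m) fun i hi => by
    rw [finrank_shift_eq_zero k (h (-i) (by omega)), Nat.cast_zero, mul_zero]]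
  refine mul_ne_zero (Units.ne_zero _) (Nat.cast_ne_zero.2 fun h0 => hm ?_)
  have := hfin (X⟦-m⟧) L
  have := Module.finrank_zero_iff.1 h0
  exact HomZero.of_shift_left_zero (a := -m) (fun f => Subsingleton.elim _ _) m (by ring)

omit [HasBinaryBiproducts C] in
lemma eulerForm_triangle (hfin : HomFinite (C := C) k) (L : C)
    (hL : ∀ X : C, {i : ℤ | ¬ HomZero X L i}.Finite) {T : Triangle C} (hT : T ∈ distTriang C) :
    eulerForm k T.obj₂ L = eulerForm k T.obj₁ L + eulerForm k T.obj₃ L := by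
  let d : C → ℤ → ℤ := fun X i => (i.negOnePow : ℤ) * Module.finrank k (X⟦i⟧ ⟶ L)
  have hd (X : C) : (Function.support (d X)).Finite :=
    (finite_support_finrank k (hL X)).subset fun i hi h => hi (by simp [d, h])
  let T' (i : ℤ) : Triangle C := (CategoryTheory.shiftFunctor (Triangle C) i).obj T
  have hT' (i : ℤ) : T' i ∈ distTriang C := Triangle.shift_distinguished T hT i
  let F (i : ℤ) : ℕ := precompRank k L (T.mor₁⟦i⟧')
  let G (i : ℤ) : ℕ := precompRank k L (T.mor₂⟦i⟧')
  let H (i : ℤ) : ℕ := precompRank k L (T' i).mor₃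
  have h₂ (i : ℤ) : Module.finrank k (T.obj₂⟦i⟧ ⟶ L) = F i + G i :=
    (finrank_hom_eq_precompRank_add k hfin L (hT' i)).trans
      (congrArg₂ (· + ·) (precompRank_units_smul k L _ _) (precompRank_units_smul k L _ _))
  have h₃ (i : ℤ) : Module.finrank k (T.obj₃⟦i⟧ ⟶ L) = G i + H i :=
    (finrank_hom_eq_precompRank_add k hfin L (rot_of_distTriang _ (hT' i))).trans
      (congrArg (· + H i) (precompRank_units_smul k L _ _))
  have h₁ (i : ℤ) : Module.finrank k (T.obj₁⟦i + 1⟧ ⟶ L) = H i + F (i + 1) := by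
    have e := finrank_hom_eq_precompRank_add k hfin L
      (rot_of_distTriang _ (rot_of_distTriang _ (hT' i)))
    have e₁ : Module.finrank k (T.obj₁⟦i + 1⟧ ⟶ L) =
        Module.finrank k (T.obj₁⟦i⟧⟦(1:ℤ)⟧ ⟶ L) :=
      LinearEquiv.finrank_eq (Linear.homCongr k
        ((shiftFunctorAdd' C i 1 (i + 1) rfl).app T.obj₁) (Iso.refl L))
    have e₂ : precompRank k L (-((i.negOnePow • T.mor₁⟦i⟧')⟦(1:ℤ)⟧')) = F (i + 1) := by
      rw [precompRank_neg, Functor.map_units_smul, precompRank_units_smul]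
      exact (precompRank_of_isos k L _ _ ((shiftFunctorAdd' C i 1 (i + 1) rfl).app T.obj₁)
        ((shiftFunctorAdd' C i 1 (i + 1) rfl).app T.obj₂)
        ((shiftFunctorAdd' C i 1 (i + 1) rfl).hom.naturality T.mor₁)).symm
    exact e₁.trans (e.trans (congrArg (H i + ·) e₂))
  let s : ℤ → ℤ := fun i => (i.negOnePow : ℤ) * H i
  have hs : (Function.support s).Finite :=
    (finite_support_finrank k (hL T.obj₃)).subset fun i hi h => hi (by
      rw [h₃] at h
      simp [s, show H i = 0 by omega])
  have hsucc : (Function.support fun i => s (i - 1)).Finite :=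
    (hs.image (· + 1)).subset fun i hi => ⟨i - 1, hi, by simp⟩
  have hsum : ∑ᶠ i, s (i - 1) = ∑ᶠ i, s i := finsum_comp_equiv (Equiv.subRight 1)
  have key (i : ℤ) : d T.obj₂ i + s i = d T.obj₁ i + d T.obj₃ i + s (i - 1) := by
    have h₁' := h₁ (i - 1)
    rw [sub_add_cancel] at h₁'
    simp only [d, s, h₁', h₂, h₃, Int.negOnePow_sub, Int.negOnePow_one]
    push_cast
    ring
  have := finsum_congr key
  rw [finsum_add_distrib (hd _) hs, finsum_add_distrib (((hd _).union (hd _)).subset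
    (Function.support_add _ _)) hsucc, finsum_add_distrib (hd _) (hd _), hsum] at this
  exact add_right_cancel this

/-- The Euler form as a functional on the Grothendieck group. -/
lemma exists_eulerForm_hom (hfin : HomFinite (C := C) k) {S : C} (hS : BoundedSilting S) (L : C) :
    ∃ φ : K0 (thickObj S) →+ ℤ, ∀ X : C, φ (K0cls (thickObj S) X) = eulerForm k X L := by
  let ψ : FreeAbelianGroup C →+ ℤ := FreeAbelianGroup.lift fun X => eulerForm k X L
  have hψ : K0Rel (thickObj S) ≤ ψ.ker := by
    rw [K0Rel, AddSubgroup.closure_le]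
    rintro x (⟨X, hX, -⟩ | ⟨T, hT, -, -, -, rfl⟩)
    · exact (hX (hS.thickObj X)).elim
    · have := eulerForm_triangle k hfin L (fun X => hS.finite_homZero X L) hT
      simp [ψ, this]
  exact ⟨QuotientAddGroup.lift _ ψ hψ, fun X => by simp [K0cls, ψ]⟩

end EulerForm

/-- Each member of a presilting sequence is detected by an object which is orthogonal to all later
members. -/
lemma PresiltSeq.exists_eulerForm_triangular {k : Type w} [Field k] [Linear k C]
    (hfin : HomFinite (C := C) k) {Amb : C → Prop} {S : C} {l : List C}
    (hseq : PresiltSeq Amb S l) (hS : Truncates Amb S) (s : ℕ) (hs : s < l.length) :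
    ∃ B : C, Amb B ∧ eulerForm k l[s] B ≠ 0 ∧
      ∀ (j : ℕ) (hj : j < l.length), s < j → eulerForm k l[j] B = 0 := by
  induction hseq with
  | nil => simp at hs
  | cons Amb S X l hX h2 hpre hind Q X₀ i p β hB hX₀ happrox T' A f g h hTr hA hT' hrest ih =>
    rw [List.length_append, List.length_singleton] at hs
    by_cases hsl : s < l.length
    · obtain ⟨B, ⟨hB₁, hB₂⟩, hne, hlt⟩ := ih (hS.perp h2 fun Z hZ n H =>
        HomZero.of_bongartz hB hX₀ hTr hA hZ H) hsl
      refine ⟨B, hB₁, by rwa [List.getElem_append_left hsl], fun j hj hsj => ?_⟩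
      by_cases hjl : j < l.length
      · rw [List.getElem_append_left hjl]
        exact hlt j hjl hsj
      · rw [List.getElem_append_right (by omega), List.getElem_singleton]
        exact eulerForm_eq_zero k hB₂
    · obtain ⟨B, m, hB₁, hB₂, hB₃⟩ := hS.exists_concentrated hX h2 hpre hind.1
      refine ⟨B, hB₁, ?_, fun j hj hsj => ?_⟩
      · rw [List.getElem_append_right (by omega), List.getElem_singleton]
        exact eulerForm_ne_zero k hfin hB₂ hB₃
      · rw [List.length_append, List.length_singleton] at hj
        omega

lemma linearIndependent_of_triangular {M : Type*} [AddCommGroup M] {n : ℕ} (x : Fin n → M)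
    (φ : Fin n → M →+ ℤ) (hne : ∀ s, φ s (x s) ≠ 0) (hlt : ∀ s j, s < j → φ s (x j) = 0) :
    LinearIndependent ℤ x := by
  rw [Fintype.linearIndependent_iff]
  intro c hc s
  induction s using WellFoundedLT.induction with
  | ind s ih =>
    have h := congrArg (φ s) hc
    rw [map_sum, map_zero, Finset.sum_eq_single s] at h
    · rw [map_zsmul, smul_eq_mul] at h
      exact (mul_eq_zero.1 h).resolve_right (hne s)
    · intro j _ hj
      obtain hj | hj := lt_or_gt_of_ne hj
      · rw [ih j hj, zero_smul, map_zero]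
      · rw [map_zsmul, hlt s j hj, smul_zero]
    · simp

/-- The classes of the members of a `2_S`-term presilting sequence are
linearly independent in the Grothendieck group `K₀(thick(S))`. -/
theorem statement15 {k : Type w} [Field k] [Linear k C] (hfin : HomFinite (C := C) k)
    (hKS : KrullSchmidt (C := C)) (S : C) (hS : BoundedSilting S)
    (l : List C) (hseq : PresiltSeq (fun _ : C => True) S l) :
    LinearIndependent ℤ (fun i : Fin l.length => K0cls (thickObj S) (l.get i)) := by
  choose B _ hne hlt using
    fun s : Fin l.length => hseq.exists_eulerForm_triangular hfin
      (Truncates.of_partialSilting hS.1.1) s s.2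
  choose φ hφ using exists_eulerForm_hom k hfin hS
  refine linearIndependent_of_triangular _ (fun s => φ (B s)) (fun s => ?_) fun s j hsj => ?_
  · rw [hφ]
    exact hne s
  · rw [hφ]
    exact hlt s j j.2 hsj

end Paper
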